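/- Let n ≥ 1, M ≥ 1, let (Ω, 𝔽, μ) be a probability space, and let X : Ω → ℝⁿ be a measurable random vector taking values in the probability simplex Δⁿ. Conditionally on X = p, let ξ_1, …, ξ_M be independent categorical random variables on {1, …, n} with parameter p (formally, the joint law of (X, ξ_1, …, ξ_M) is given by the law of X composed with the M-fold product of the categorical kernel). Then for every fixed q ∈ ℝⁿ, the total expectation of ‖(1/M) ∑_{r=1}^M e_{ξ_r} − q‖₂² is at most 2/M + 2 · E‖X − q‖₂², where e_i ∈ ℝⁿ is the i-th standard unit vector. -/

import Mathlib

open scoped BigOperators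
open MeasureTheory

/-- Second moment of a translated sum of `M` independent copies of a centered finitely supported
random vector. -/
theorem sum_prod_mul_norm_add_sum_sq {ι E : Type*} [Fintype ι] [NormedAddCommGroup E]
    [InnerProductSpace ℝ E] (p : ι → ℝ) (hp : ∑ i, p i = 1) (w : ι → E)
    (hw : ∑ i, p i • w i = 0) (M : ℕ) (a : E) :
    ∑ ξ : Fin M → ι, (∏ r, p (ξ r)) * ‖a + ∑ r, w (ξ r)‖ ^ 2
      = ‖a‖ ^ 2 + M * ∑ i, p i * ‖w i‖ ^ 2 := by
  induction M generalizing a with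
  | zero => simp
  | succ M ih =>
    have hinner : ∑ i, p i * inner ℝ a (w i) = 0 := by
      simp_rw [← real_inner_smul_right, ← inner_sum, hw, inner_zero_right]
    rw [← (Fin.consEquiv fun _ => ι).sum_comp, Fintype.sum_prod_type]
    simp only [Fin.consEquiv_apply, Fin.prod_univ_succ, Fin.sum_univ_succ, Fin.cons_zero,
      Fin.cons_succ, mul_assoc, ← Finset.mul_sum, ← add_assoc, ih]
    calc ∑ i, p i * (‖a + w i‖ ^ 2 + M * ∑ j, p j * ‖w j‖ ^ 2)
        = ∑ i, (p i * (‖a‖ ^ 2 + M * ∑ j, p j * ‖w j‖ ^ 2) + 2 * (p i * inner ℝ a (w i))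
            + p i * ‖w i‖ ^ 2) := by
          refine Finset.sum_congr rfl fun i _ => ?_
          rw [norm_add_sq_real]
          ring
      _ = _ := by
          rw [Finset.sum_add_distrib, Finset.sum_add_distrib, ← Finset.sum_mul,
            ← Finset.mul_sum, hp, hinner]
          push_cast
          ring

/-- The barycenter of the standard basis with weights `p` is `p`. -/
theorem sum_smul_euclideanSpace_single {ι : Type*} [Fintype ι] [DecidableEq ι]
    (p : EuclideanSpace ℝ ι) :
    ∑ i, p i • EuclideanSpace.single i (1 : ℝ) = p := by
  ext j
  simp [Pi.single_apply]

/-- The trace of the covariance of a categorical variable with parameter `p` is `1 - ‖p‖ ^ 2`. -/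
theorem sum_mul_norm_single_sub_sq {ι : Type*} [Fintype ι] [DecidableEq ι]
    (p : EuclideanSpace ℝ ι) (hp : ∑ i, p i = 1) :
    ∑ i, p i * ‖EuclideanSpace.single i (1 : ℝ) - p‖ ^ 2 = 1 - ‖p‖ ^ 2 := by
  have hinner : ∑ i, p i * inner ℝ (EuclideanSpace.single i (1 : ℝ)) p = ‖p‖ ^ 2 := by
    simp_rw [← real_inner_smul_left, ← sum_inner, sum_smul_euclideanSpace_single,
      real_inner_self_eq_norm_sq]
  calc ∑ i, p i * ‖EuclideanSpace.single i (1 : ℝ) - p‖ ^ 2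
      = ∑ i, (p i * (1 + ‖p‖ ^ 2)
          - 2 * (p i * inner ℝ (EuclideanSpace.single i (1 : ℝ)) p)) := by
        refine Finset.sum_congr rfl fun i _ => ?_
        rw [norm_sub_sq_real, PiLp.norm_single, norm_one]
        ring
    _ = 1 - ‖p‖ ^ 2 := by
        rw [Finset.sum_sub_distrib, ← Finset.sum_mul, ← Finset.mul_sum, hp, hinner]
        ring

/-- Bias-variance decomposition for the mean of `M` independent categorical samples. -/
theorem sum_prod_mul_norm_mean_single_sub_sq {ι : Type*} [Fintype ι] [DecidableEq ι] {M : ℕ}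
    (hM : M ≠ 0) (p : EuclideanSpace ℝ ι) (hp : ∑ i, p i = 1) (q : EuclideanSpace ℝ ι) :
    ∑ ξ : Fin M → ι, (∏ r, p (ξ r)) *
        ‖(1 / (M : ℝ)) • (∑ r, EuclideanSpace.single (ξ r) (1 : ℝ)) - q‖ ^ 2
      = ‖p - q‖ ^ 2 + (1 - ‖p‖ ^ 2) / M := by
  have hM' : (M : ℝ) ≠ 0 := Nat.cast_ne_zero.mpr hM
  have hw : ∑ i, p i • ((1 / (M : ℝ)) • (EuclideanSpace.single i (1 : ℝ) - p)) = 0 := by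
    simp_rw [smul_comm (p _) (1 / (M : ℝ)), ← Finset.smul_sum, smul_sub,
      Finset.sum_sub_distrib, ← Finset.sum_smul, sum_smul_euclideanSpace_single, hp, one_smul,
      sub_self, smul_zero]
  have hvar : ∑ i, p i * ‖(1 / (M : ℝ)) • (EuclideanSpace.single i (1 : ℝ) - p)‖ ^ 2
      = (1 / (M : ℝ)) ^ 2 * (1 - ‖p‖ ^ 2) := by
    rw [← sum_mul_norm_single_sub_sq p hp, Finset.mul_sum]
    refine Finset.sum_congr rfl fun i _ => ?_
    rw [norm_smul, mul_pow, Real.norm_eq_abs, sq_abs]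
    ring
  have hmain := sum_prod_mul_norm_add_sum_sq p hp _ hw M (p - q)
  rw [hvar] at hmain
  convert hmain using 1
  · refine Finset.sum_congr rfl fun ξ _ => ?_
    congr 3
    rw [← Finset.smul_sum, Finset.sum_sub_distrib, Finset.sum_const, Finset.card_univ,
      Fintype.card_fin, smul_sub, ← Nat.cast_smul_eq_nsmul ℝ, smul_smul, one_div_mul_cancel hM',
      one_smul]
    abel
  · field_simp

/-- Points of the probability simplex have Euclidean norm at most `1`. -/
theorem EuclideanSpace.norm_le_one_of_mem_simplex {ι : Type*} [Fintype ι]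
    (p : EuclideanSpace ℝ ι) (h0 : ∀ i, 0 ≤ p i) (h1 : ∑ i, p i = 1) : ‖p‖ ≤ 1 := by
  have hle : ∀ i, p i ≤ 1 := fun i =>
    h1 ▸ Finset.single_le_sum (fun j _ => h0 j) (Finset.mem_univ i)
  rw [← sq_le_one_iff₀ (norm_nonneg p), EuclideanSpace.real_norm_sq_eq, ← h1]
  exact Finset.sum_le_sum fun i _ => by nlinarith [h0 i, hle i]

/-- Double-sampling variance bound (Lemma 3): if `X` is a random vector in the
    probability simplex and, conditionally on `X = p`, `ξ₁,…,ξ_M` are i.i.d.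
    categorical with parameter `p` (the conditional expectation being written
    as the finite sum over outcomes `ξ : Fin M → Fin n` weighted by
    `∏ᵣ p(ξᵣ)`), then for every fixed `q`,
    `E‖(1/M)∑ᵣ e_{ξᵣ} − q‖₂² ≤ 2/M + 2·E‖X − q‖₂²`. -/
theorem stmt_9 (n M : ℕ) (hn : 1 ≤ n) (hM : 1 ≤ M)
    {Ω : Type*} [MeasurableSpace Ω] (μ : Measure Ω) [IsProbabilityMeasure μ]
    (X : Ω → EuclideanSpace ℝ (Fin n)) (hX : Measurable X)
    (hXsimplex : ∀ ω, (∀ i, 0 ≤ X ω i) ∧ ∑ i, X ω i = 1)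
    (q : EuclideanSpace ℝ (Fin n)) :
    (∫ ω, ∑ ξ : Fin M → Fin n, (∏ r, X ω (ξ r)) *
          ‖(1 / (M : ℝ)) • (∑ r, EuclideanSpace.single (ξ r) (1 : ℝ)) - q‖ ^ 2 ∂μ)
      ≤ 2 / (M : ℝ) + 2 * ∫ ω, ‖X ω - q‖ ^ 2 ∂μ := by
  have hint : Integrable (fun ω => ‖X ω - q‖ ^ 2) μ := by
    refine Integrable.of_bound (by fun_prop) ((1 + ‖q‖) ^ 2) (.of_forall fun ω => ?_)
    have hXω := EuclideanSpace.norm_le_one_of_mem_simplex (X ω) (hXsimplex ω).1 (hXsimplex ω).2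
    rw [Real.norm_of_nonneg (sq_nonneg _)]
    gcongr
    exact (norm_sub_le _ _).trans (by gcongr)
  have hM0 : M ≠ 0 := by omega
  have hpoint : ∀ ω, ‖X ω - q‖ ^ 2 + (1 - ‖X ω‖ ^ 2) / M
      ≤ 2 / (M : ℝ) + 2 * ‖X ω - q‖ ^ 2 := fun ω => by
    have hdiv : (1 - ‖X ω‖ ^ 2) / M ≤ 2 / (M : ℝ) := by
      gcongr
      nlinarith [sq_nonneg ‖X ω‖]
    linarith [sq_nonneg ‖X ω - q‖]
  calc _ ≤ ∫ ω, (2 / (M : ℝ) + 2 * ‖X ω - q‖ ^ 2) ∂μ := by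
        refine integral_mono_of_nonneg (.of_forall fun ω => ?_)
          ((integrable_const _).add (hint.const_mul 2)) (.of_forall fun ω => ?_)
        · exact Finset.sum_nonneg fun ξ _ =>
            mul_nonneg (Finset.prod_nonneg fun r _ => (hXsimplex ω).1 _) (sq_nonneg _)
        · exact (sum_prod_mul_norm_mean_single_sub_sq hM0 _ (hXsimplex ω).2 q).trans_le (hpoint ω)
    _ = _ := by
        rw [integral_add (integrable_const _) (hint.const_mul 2), integral_const_mul]
        simp
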